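/- arXiv:1104.1711 — 8 statements merged into one kernel-verified Lean document; each statement's English description precedes it below -/
import Mathlib

section
/- Let V be a real vector space and let P ⊆ F ⊆ E be linear subspaces, each equipped with a quasi-norm ‖·‖_P, ‖·‖_F, ‖·‖_E respectively, with E and F complete. Suppose there exist constants C > 0 and β > 0 such that the Jackson-type inequality t^β · 𝓔(f,t) ≤ C‖f‖_F holds for all f ∈ F and all t > 0, where 𝓔(f,t) = inf{‖f−g‖_E : g ∈ P, ‖g‖_P ≤ t}. Then for every 0 < θ < 1 and 1 < q < ∞ there exists a constant C′ > 0 such that for all f ∈ E: (∫₀^∞ (t^{θβ} 𝓔(f,t))^q dt/t)^{1/q} ≤ C′ · (∫₀^∞ (t^{−θ} K(f,t,E,F))^q dt/t)^{1/q}, i.e. the interpolation space (E,F)^K_{θ,q} embeds into the approximation space 𝓔_{θβ,q}(E,P). -/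
open MeasureTheory Set Filter
open scoped ENNReal

variable {V : Type*} [AddCommGroup V] [Module ℝ V]

/-- `N` is a quasi-norm on the linear subspace `S` of `V`. -/
structure IsQuasiNorm (S : Submodule ℝ V) (N : V → ℝ) : Prop where
  nonneg : ∀ f ∈ S, 0 ≤ N f
  eq_zero_iff : ∀ f ∈ S, (N f = 0 ↔ f = 0)
  norm_neg : ∀ f ∈ S, N (-f) = N f
  triangle : ∃ C : ℝ, 1 ≤ C ∧ ∀ f₁ ∈ S, ∀ f₂ ∈ S, N (f₁ + f₂) ≤ C * (N f₁ + N f₂)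

/-- The Peetre K-functional of the pair `(A, B)` of quasi-normed subspaces:
`K(f,t,A,B) = inf {‖f₀‖_A + t‖f₁‖_B : f = f₀ + f₁, f₀ ∈ A, f₁ ∈ B}`. -/
noncomputable def Kfun (A B : Submodule ℝ V) (NA NB : V → ℝ) (f : V) (t : ℝ) : ℝ :=
  sInf {x : ℝ | ∃ f₀ ∈ A, ∃ f₁ ∈ B, f = f₀ + f₁ ∧ x = NA f₀ + t * NB f₁}

/-- The approximation functional `𝓔(f,t) = inf {‖f - g‖_E : g ∈ P, ‖g‖_P ≤ t}`. -/
noncomputable def Efun (E P : Submodule ℝ V) (NE NP : V → ℝ) (f : V) (t : ℝ) : ℝ :=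
  sInf {x : ℝ | ∃ g ∈ P, NP g ≤ t ∧ x = NE (f - g)}

/-- Completeness of the quasi-normed subspace `(S, N)`: every Cauchy sequence converges. -/
def QComplete (S : Submodule ℝ V) (N : V → ℝ) : Prop :=
  ∀ u : ℕ → V, (∀ n, u n ∈ S) →
    Tendsto (fun p : ℕ × ℕ => N (u p.1 - u p.2)) atTop (nhds 0) →
    ∃ f ∈ S, Tendsto (fun n => N (u n - f)) atTop (nhds 0)

/-- The integral `∫₀^∞ (t^e · g t)^q dt/t`, valued in `ℝ≥0∞`. -/
noncomputable def qInt (g : ℝ → ℝ) (e q : ℝ) : ℝ≥0∞ :=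
  ∫⁻ t in Ioi (0 : ℝ), ENNReal.ofReal (t ^ e * g t) ^ q * ENNReal.ofReal t⁻¹

/-- The change of variables `s = t ^ (-β)` in `qInt`. -/
theorem qInt_comp_rpow_neg (g : ℝ → ℝ) (θ q β : ℝ) (hβ : 0 < β) :
    qInt g (-θ) q =
      ENNReal.ofReal β * qInt (fun t => g (t ^ (-β))) (θ * β) q := by
  have himage : (fun t : ℝ => t ^ (-β)) '' Ioi 0 = Ioi 0 := by
    ext s
    constructor
    · rintro ⟨t, ht, rfl⟩
      exact Real.rpow_pos_of_pos ht _
    · intro hs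
      refine ⟨s ^ (-β)⁻¹, Real.rpow_pos_of_pos hs _, ?_⟩
      exact Real.rpow_inv_rpow (le_of_lt hs) (by linarith)
  have hinj : InjOn (fun t : ℝ => t ^ (-β)) (Ioi 0) := by
    intro x hx y hy hxy
    exact (Real.rpow_left_inj (le_of_lt hx) (le_of_lt hy) (by linarith)).1 hxy
  have hderiv : ∀ t ∈ Ioi (0 : ℝ),
      HasDerivWithinAt (fun t : ℝ => t ^ (-β)) (-β * t ^ (-β - 1)) (Ioi 0) t :=
    fun t ht => (Real.hasDerivAt_rpow_const (Or.inl (ne_of_gt ht))).hasDerivWithinAt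
  have hsubst := lintegral_image_eq_lintegral_abs_deriv_mul measurableSet_Ioi hderiv hinj
    (fun t => ENNReal.ofReal (t ^ (-θ) * g t) ^ q * ENNReal.ofReal t⁻¹)
  rw [himage] at hsubst
  unfold qInt
  rw [hsubst, ← lintegral_const_mul' _ _ ENNReal.ofReal_ne_top]
  refine setLIntegral_congr_fun measurableSet_Ioi fun t ht => ?_
  have ht' : (0 : ℝ) < t := ht
  have hexp : (t ^ (-β)) ^ (-θ) = t ^ (θ * β) := by
    rw [← Real.rpow_mul ht'.le]
    ring_nf
  have habs : |-β * t ^ (-β - 1)| = β * t ^ (-β - 1) := by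
    rw [abs_mul, abs_neg, abs_of_pos hβ, abs_of_pos (Real.rpow_pos_of_pos ht' _)]
  have hweight : β * t ^ (-β - 1) * (t ^ (-β))⁻¹ = β * t⁻¹ := by
    rw [Real.rpow_sub_one ht'.ne']
    have := (Real.rpow_pos_of_pos ht' (-β)).ne'
    field_simp
  have hweight' : ENNReal.ofReal (β * t ^ (-β - 1)) * ENNReal.ofReal (t ^ (-β))⁻¹ =
      ENNReal.ofReal β * ENNReal.ofReal t⁻¹ := by
    rw [← ENNReal.ofReal_mul (by positivity), hweight, ENNReal.ofReal_mul hβ.le]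
  simp only [hexp, habs]
  rw [mul_left_comm, hweight', mul_left_comm]

/-- A pointwise bound `g ≤ M * h` on `(0, ∞)` passes to `qInt`. -/
theorem qInt_le_of_le_mul {g h : ℝ → ℝ} {M e q : ℝ} (hM : 0 ≤ M) (hq : 0 ≤ q)
    (hgh : ∀ t, 0 < t → g t ≤ M * h t) :
    qInt g e q ≤ ENNReal.ofReal M ^ q * qInt h e q := by
  unfold qInt
  rw [← lintegral_const_mul' _ _ (ENNReal.rpow_ne_top_of_nonneg hq ENNReal.ofReal_ne_top)]
  refine setLIntegral_mono' measurableSet_Ioi fun t ht => ?_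
  have ht' : (0 : ℝ) < t := ht
  rw [← mul_assoc, ← ENNReal.mul_rpow_of_nonneg _ _ hq, ← ENNReal.ofReal_mul hM]
  have hbound : t ^ e * g t ≤ M * (t ^ e * h t) := by
    rw [mul_left_comm]
    exact mul_le_mul_of_nonneg_left (hgh t ht') (Real.rpow_pos_of_pos ht' _).le
  gcongr ENNReal.ofReal ?_ ^ q * _

/-- Splitting an element controls its approximation functional. -/
theorem Efun_add_le {P E : Submodule ℝ V} (hPE : P ≤ E) {NP NE : V → ℝ}
    (hNP : IsQuasiNorm P NP) (hNE : IsQuasiNorm E NE) {D : ℝ} (hD : 1 ≤ D)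
    (htri : ∀ f₁ ∈ E, ∀ f₂ ∈ E, NE (f₁ + f₂) ≤ D * (NE f₁ + NE f₂))
    {f₀ f₁ : V} (hf₀ : f₀ ∈ E) (hf₁ : f₁ ∈ E) {t : ℝ} (ht : 0 ≤ t) :
    Efun E P NE NP (f₀ + f₁) t ≤ D * (NE f₀ + Efun E P NE NP f₁ t) := by
  have hD' : 0 < D := by linarith
  have hbdd : BddBelow {x : ℝ | ∃ g ∈ P, NP g ≤ t ∧ x = NE (f₀ + f₁ - g)} := by
    refine ⟨0, ?_⟩
    rintro x ⟨g, hg, -, rfl⟩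
    exact hNE.nonneg _ (E.sub_mem (E.add_mem hf₀ hf₁) (hPE hg))
  have hne : {x : ℝ | ∃ g ∈ P, NP g ≤ t ∧ x = NE (f₁ - g)}.Nonempty :=
    ⟨_, 0, P.zero_mem, by rwa [(hNP.eq_zero_iff 0 P.zero_mem).2 rfl], rfl⟩
  suffices Efun E P NE NP (f₀ + f₁) t / D - NE f₀ ≤ Efun E P NE NP f₁ t by
    rw [mul_comm, ← div_le_iff₀ hD']
    linarith
  refine le_csInf hne ?_
  rintro x ⟨g, hg, hgt, rfl⟩
  rw [sub_le_iff_le_add', div_le_iff₀' hD']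
  refine (csInf_le hbdd ⟨g, hg, hgt, rfl⟩).trans ?_
  rw [add_sub_assoc]
  exact htri _ hf₀ _ (E.sub_mem hf₁ (hPE hg))

/-- A Jackson-type inequality bounds the approximation functional by the K-functional. -/
theorem Efun_le_Kfun {P F E : Submodule ℝ V} (hPF : P ≤ F) (hFE : F ≤ E) {NP NF NE : V → ℝ}
    (hNP : IsQuasiNorm P NP) (hNF : IsQuasiNorm F NF) (hNE : IsQuasiNorm E NE)
    {D : ℝ} (hD : 1 ≤ D)
    (htri : ∀ f₁ ∈ E, ∀ f₂ ∈ E, NE (f₁ + f₂) ≤ D * (NE f₁ + NE f₂)) {C β : ℝ}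
    (jackson : ∀ f ∈ F, ∀ t : ℝ, 0 < t → t ^ β * Efun E P NE NP f t ≤ C * NF f)
    {f : V} (hf : f ∈ E) {t : ℝ} (ht : 0 < t) :
    Efun E P NE NP f t ≤ D * max 1 C * Kfun E F NE NF f (t ^ (-β)) := by
  have hD' : 0 < D := by linarith
  have hM : 0 < D * max 1 C := mul_pos hD' (lt_max_of_lt_left one_pos)
  rw [← div_le_iff₀' hM]
  refine le_csInf ⟨_, f, hf, 0, F.zero_mem, (add_zero f).symm, rfl⟩ ?_
  rintro x ⟨f₀, hf₀, f₁, hf₁, rfl, rfl⟩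
  rw [div_le_iff₀' hM, mul_assoc]
  refine (Efun_add_le (hPF.trans hFE) hNP hNE hD htri hf₀ (hFE hf₁) ht.le).trans ?_
  have hpow := Real.rpow_pos_of_pos ht β
  have happrox : Efun E P NE NP f₁ t ≤ C * (t ^ (-β) * NF f₁) := by
    rw [Real.rpow_neg ht.le, mul_left_comm, ← div_eq_inv_mul, le_div_iff₀' hpow]
    exact jackson f₁ hf₁ t ht
  have h₀ := hNE.nonneg f₀ hf₀
  have h₁ : 0 ≤ t ^ (-β) * NF f₁ :=
    mul_nonneg (Real.rpow_pos_of_pos ht _).le (hNF.nonneg f₁ hf₁)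
  have hmax₀ := mul_le_mul_of_nonneg_right (le_max_left 1 C) h₀
  have hmax₁ := mul_le_mul_of_nonneg_right (le_max_right 1 C) h₁
  exact mul_le_mul_of_nonneg_left (by linarith) hD'.le

/-- **Direct approximation theorem (Theorem 4.4).** If the Jackson-type inequality
`t^β 𝓔(f,t) ≤ C ‖f‖_F` holds on `F`, then the interpolation space `(E,F)^K_{θ,q}`
embeds into the approximation space `𝓔_{θβ,q}(E,P)`. -/
theorem directApproximationTheorem
    (P F E : Submodule ℝ V) (hPF : P ≤ F) (hFE : F ≤ E)
    (NP NF NE : V → ℝ)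
    (hNP : IsQuasiNorm P NP) (hNF : IsQuasiNorm F NF) (hNE : IsQuasiNorm E NE)
    (hFcomplete : QComplete F NF) (hEcomplete : QComplete E NE)
    (C β : ℝ) (hC : 0 < C) (hβ : 0 < β)
    (jackson : ∀ f ∈ F, ∀ t : ℝ, 0 < t → t ^ β * Efun E P NE NP f t ≤ C * NF f)
    (θ q : ℝ) (hθ₀ : 0 < θ) (hθ₁ : θ < 1) (hq : 1 < q) :
    ∃ C' : ℝ, 0 < C' ∧ ∀ f ∈ E,
      (qInt (Efun E P NE NP f) (θ * β) q) ^ (1 / q) ≤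
        ENNReal.ofReal C' * (qInt (Kfun E F NE NF f) (-θ) q) ^ (1 / q) := by
  obtain ⟨D, hD, htri⟩ := hNE.triangle
  have hq' : 0 < q := by linarith
  have hM : 0 < D * max 1 C := mul_pos (by linarith) (lt_max_of_lt_left one_pos)
  have hβ' : 0 < β⁻¹ := inv_pos.2 hβ
  refine ⟨D * max 1 C * β⁻¹ ^ (1 / q), mul_pos hM (Real.rpow_pos_of_pos hβ' _), fun f hf => ?_⟩
  have hβ_cancel : ENNReal.ofReal β⁻¹ * ENNReal.ofReal β = 1 := by
    rw [← ENNReal.ofReal_mul hβ'.le, inv_mul_cancel₀ hβ.ne', ENNReal.ofReal_one]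
  have hbound : qInt (Efun E P NE NP f) (θ * β) q ≤
      ENNReal.ofReal (D * max 1 C) ^ q *
        (ENNReal.ofReal β⁻¹ * qInt (Kfun E F NE NF f) (-θ) q) := by
    rw [qInt_comp_rpow_neg _ θ q β hβ, ← mul_assoc (ENNReal.ofReal β⁻¹), hβ_cancel, one_mul]
    exact qInt_le_of_le_mul hM.le hq'.le fun t ht =>
      Efun_le_Kfun hPF hFE hNP hNF hNE hD htri jackson hf ht
  have hq_inv : 0 ≤ 1 / q := by positivity
  refine (ENNReal.rpow_le_rpow hbound hq_inv).trans_eq ?_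
  rw [ENNReal.mul_rpow_of_nonneg _ _ hq_inv, ENNReal.mul_rpow_of_nonneg _ _ hq_inv,
    ← ENNReal.rpow_mul, mul_one_div_cancel hq'.ne', ENNReal.rpow_one,
    ENNReal.ofReal_mul hM.le, ENNReal.ofReal_rpow_of_pos hβ', mul_assoc]
end

section
/- Let V be a real vector space and let P ⊆ F ⊆ E be linear subspaces, each equipped with a quasi-norm. Suppose there exist constants C > 0 and β > 0 such that t^β · 𝓔(f,t) ≤ C‖f‖_F for all f ∈ F and all t > 0, where 𝓔(f,t) = inf{‖f−g‖_E : g ∈ P, ‖g‖_P ≤ t}. Then there exists a constant C′ > 0 such that for every f ∈ F and every s > 0: K(f,s,P,E) ≤ C′ · s^{1/(1+β)} · ‖f‖_F^{1/(1+β)}, where K(f,s,P,E) = inf{‖f₀‖_P + s‖f₁‖_E : f = f₀ + f₁, f₀ ∈ P, f₁ ∈ E}. -/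
open MeasureTheory Set Filter
open scoped ENNReal

variable {V : Type*} [AddCommGroup V] [Module ℝ V]

/-- The K-functional is at most the value of any admissible decomposition. -/
lemma Kfun_le {A B : Submodule ℝ V} {NA NB : V → ℝ}
    (hNA : IsQuasiNorm A NA) (hNB : IsQuasiNorm B NB) {f₀ f₁ : V} (h₀ : f₀ ∈ A) (h₁ : f₁ ∈ B)
    {s : ℝ} (hs : 0 ≤ s) : Kfun A B NA NB (f₀ + f₁) s ≤ NA f₀ + s * NB f₁ := by
  refine csInf_le ⟨0, ?_⟩ ⟨f₀, h₀, f₁, h₁, rfl, rfl⟩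
  rintro x ⟨g₀, hg₀, g₁, hg₁, -, rfl⟩
  have := hNA.nonneg g₀ hg₀
  have := hNB.nonneg g₁ hg₁
  positivity

/-- The K-functional is controlled by the approximation functional at any level `t`. -/
lemma Kfun_le_add_mul_Efun {P E : Submodule ℝ V} (hPE : P ≤ E) {NP NE : V → ℝ}
    (hNP : IsQuasiNorm P NP) (hNE : IsQuasiNorm E NE) {f : V} (hf : f ∈ E)
    {s t : ℝ} (hs : 0 < s) (ht : 0 ≤ t) :
    Kfun P E NP NE f s ≤ t + s * Efun E P NE NP f t := by
  rw [← sub_le_iff_le_add', ← div_le_iff₀' hs]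
  refine le_csInf ⟨_, 0, P.zero_mem, ?_, rfl⟩ ?_
  · rwa [(hNP.eq_zero_iff 0 P.zero_mem).2 rfl]
  · rintro x ⟨g, hg, hgt, rfl⟩
    have h := Kfun_le hNP hNE hg (E.sub_mem hf (hPE hg)) hs.le
    rw [add_sub_cancel] at h
    rw [div_le_iff₀' hs]
    linarith

/-- If the Jackson-type inequality `t^β 𝓔(f,t) ≤ C ‖f‖_F` holds on `F`, then
`K(f,s,P,E) ≤ C' s^{1/(1+β)} ‖f‖_F^{1/(1+β)}` for all `f ∈ F` and `s > 0`. -/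
theorem K_bound_of_jackson
    (P F E : Submodule ℝ V) (hPF : P ≤ F) (hFE : F ≤ E)
    (NP NF NE : V → ℝ)
    (hNP : IsQuasiNorm P NP) (hNF : IsQuasiNorm F NF) (hNE : IsQuasiNorm E NE)
    (C β : ℝ) (hC : 0 < C) (hβ : 0 < β)
    (jackson : ∀ f ∈ F, ∀ t : ℝ, 0 < t → t ^ β * Efun E P NE NP f t ≤ C * NF f) :
    ∃ C' : ℝ, 0 < C' ∧ ∀ f ∈ F, ∀ s : ℝ, 0 < s →
      Kfun P E NP NE f s ≤ C' * s ^ (1 / (1 + β)) * (NF f) ^ (1 / (1 + β)) := by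
  refine ⟨1 + C, by positivity, fun f hf s hs => ?_⟩
  rcases (hNF.nonneg f hf).eq_or_lt with h0 | hpos
  · obtain rfl := (hNF.eq_zero_iff f hf).1 h0.symm
    have h := Kfun_le hNP hNE P.zero_mem E.zero_mem hs.le
    rw [add_zero, (hNP.eq_zero_iff 0 P.zero_mem).2 rfl,
      (hNE.eq_zero_iff 0 E.zero_mem).2 rfl] at h
    rw [← h0, Real.zero_rpow (by positivity)]
    linarith
  · have hsx : 0 < s * NF f := mul_pos hs hpos
    rw [mul_assoc, ← Real.mul_rpow hs.le hpos.le]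
    set t := (s * NF f) ^ (1 / (1 + β)) with ht_def
    have ht : 0 < t := Real.rpow_pos_of_pos hsx _
    have hpow : t * t ^ β = s * NF f := by
      rw [← Real.rpow_one_add' ht.le (by positivity), ht_def, ← Real.rpow_mul hsx.le,
        one_div_mul_cancel (by positivity), Real.rpow_one]
    have htβ : 0 < t ^ β := Real.rpow_pos_of_pos ht _
    have hK := Kfun_le_add_mul_Efun (hPF.trans hFE) hNP hNE (hFE hf) hs ht.le
    have hE : s * Efun E P NE NP f t ≤ C * t := by
      refine le_of_mul_le_mul_left ?_ htβ
      calc t ^ β * (s * Efun E P NE NP f t) = s * (t ^ β * Efun E P NE NP f t) := by ring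
        _ ≤ s * (C * NF f) := mul_le_mul_of_nonneg_left (jackson f hf t ht) hs.le
        _ = C * (s * NF f) := by ring
        _ = t ^ β * (C * t) := by rw [← hpow]; ring
    linarith
end

section
/- Let E and F be linear subspaces of a real vector space V, each equipped with a quasi-norm, and let T : E + F → E + F be a linear map with T(E) ⊆ E, T(F) ⊆ F, and constants M₀, M₁ > 0 such that ‖Tf‖_E ≤ M₀‖f‖_E for all f ∈ E and ‖Tf‖_F ≤ M₁‖f‖_F for all f ∈ F. Then for every 0 < θ < 1 and 0 < q < ∞ and every f ∈ E + F: (∫₀^∞ (t^{−θ} K(Tf,t,E,F))^q dt/t)^{1/q} ≤ M₀^{1−θ} M₁^{θ} · (∫₀^∞ (t^{−θ} K(f,t,E,F))^q dt/t)^{1/q}. In particular the interpolation space (E,F)^K_{θ,q} interpolates between E and F. -/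
open MeasureTheory Set Filter
open scoped ENNReal

variable {V : Type*} [AddCommGroup V] [Module ℝ V]

theorem Kfun_map_le {E F : Submodule ℝ V} {NE NF : V → ℝ}
    (hNE : ∀ f ∈ E, 0 ≤ NE f) (hNF : ∀ f ∈ F, 0 ≤ NF f)
    (T : V →ₗ[ℝ] V) (hTE : ∀ f ∈ E, T f ∈ E) (hTF : ∀ f ∈ F, T f ∈ F)
    {M₀ M₁ : ℝ} (hM₀ : 0 < M₀)
    (hTboundE : ∀ f ∈ E, NE (T f) ≤ M₀ * NE f) (hTboundF : ∀ f ∈ F, NF (T f) ≤ M₁ * NF f)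
    {f : V} (hf : f ∈ E ⊔ F) {t : ℝ} (ht : 0 ≤ t) :
    Kfun E F NE NF (T f) t ≤ M₀ * Kfun E F NE NF f (M₁ / M₀ * t) := by
  rw [mul_comm, ← div_le_iff₀ hM₀]
  refine le_csInf ?_ ?_
  · obtain ⟨f₀, h₀, f₁, h₁, rfl⟩ := Submodule.mem_sup.1 hf
    exact ⟨_, f₀, h₀, f₁, h₁, rfl, rfl⟩
  · rintro _ ⟨f₀, h₀, f₁, h₁, rfl, rfl⟩
    rw [div_le_iff₀ hM₀]
    calc Kfun E F NE NF (T (f₀ + f₁)) t ≤ NE (T f₀) + t * NF (T f₁) := by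
          refine csInf_le ⟨0, ?_⟩ ⟨_, hTE _ h₀, _, hTF _ h₁, map_add _ _ _, rfl⟩
          rintro _ ⟨g₀, k₀, g₁, k₁, -, rfl⟩
          exact add_nonneg (hNE _ k₀) (mul_nonneg ht (hNF _ k₁))
      _ ≤ M₀ * NE f₀ + t * (M₁ * NF f₁) := by
          gcongr
          exacts [hTboundE _ h₀, hTboundF _ h₁]
      _ = (NE f₀ + M₁ / M₀ * t * NF f₁) * M₀ := by field_simp

/-- The measure `dt/t` is invariant under dilations. -/
theorem qInt_eq_lintegral_dilate (g : ℝ → ℝ) (e q : ℝ) {c : ℝ} (hc : 0 < c) :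
    qInt g e q = ∫⁻ t in Ioi (0 : ℝ),
      ENNReal.ofReal ((c * t) ^ e * g (c * t)) ^ q * ENNReal.ofReal t⁻¹ := by
  have himage : (fun t => c * t) '' Ioi (0 : ℝ) = Ioi 0 := by
    rw [image_mul_left_Ioi hc, mul_zero]
  rw [qInt, ← himage, lintegral_image_eq_lintegral_abs_deriv_mul (f' := fun _ => c)
    measurableSet_Ioi (fun t _ => by simpa using ((hasDerivAt_id t).const_mul c).hasDerivWithinAt)
    (mul_right_injective₀ hc.ne').injOn, himage]
  refine setLIntegral_congr_fun measurableSet_Ioi fun t _ => ?_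
  rw [mul_left_comm, ← ENNReal.ofReal_mul (abs_nonneg c), abs_of_pos hc, mul_inv,
    mul_inv_cancel_left₀ hc.ne']

/-- A linear map which is bounded `E → E` with norm `M₀` and bounded `F → F` with
norm `M₁` is bounded on `(E,F)^K_{θ,q}` with norm at most `M₀^{1-θ} M₁^θ`; in
particular the interpolation space interpolates between `E` and `F`. -/
theorem interpolation_property
    (E F : Submodule ℝ V) (NE NF : V → ℝ)
    (hNE : IsQuasiNorm E NE) (hNF : IsQuasiNorm F NF)
    (T : V →ₗ[ℝ] V) (hTE : ∀ f ∈ E, T f ∈ E) (hTF : ∀ f ∈ F, T f ∈ F)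
    (M₀ M₁ : ℝ) (hM₀ : 0 < M₀) (hM₁ : 0 < M₁)
    (hTboundE : ∀ f ∈ E, NE (T f) ≤ M₀ * NE f)
    (hTboundF : ∀ f ∈ F, NF (T f) ≤ M₁ * NF f)
    (θ q : ℝ) (hθ₀ : 0 < θ) (hθ₁ : θ < 1) (hq : 0 < q) :
    ∀ f ∈ E ⊔ F,
      (qInt (Kfun E F NE NF (T f)) (-θ) q) ^ (1 / q) ≤
        ENNReal.ofReal (M₀ ^ (1 - θ) * M₁ ^ θ) *
          (qInt (Kfun E F NE NF f) (-θ) q) ^ (1 / q) := by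
  intro f hf
  have hc : 0 < M₁ / M₀ := div_pos hM₁ hM₀
  have hA : 0 ≤ M₀ ^ (1 - θ) * M₁ ^ θ := by positivity
  have hconst : M₀ ^ (1 - θ) * M₁ ^ θ * (M₁ / M₀) ^ (-θ) = M₀ := by
    rw [Real.div_rpow hM₁.le hM₀.le, Real.rpow_sub hM₀, Real.rpow_one, Real.rpow_neg hM₁.le,
      Real.rpow_neg hM₀.le]
    field_simp
  have hint : qInt (Kfun E F NE NF (T f)) (-θ) q ≤
      ENNReal.ofReal (M₀ ^ (1 - θ) * M₁ ^ θ) ^ q * qInt (Kfun E F NE NF f) (-θ) q := by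
    rw [qInt_eq_lintegral_dilate (Kfun E F NE NF f) (-θ) q hc, ← lintegral_const_mul' _ _
      (ENNReal.rpow_ne_top_of_nonneg hq.le ENNReal.ofReal_ne_top), qInt]
    refine setLIntegral_mono' measurableSet_Ioi fun t ht => ?_
    rw [mem_Ioi] at ht
    rw [← mul_assoc, ← ENNReal.mul_rpow_of_nonneg _ _ hq.le, ← ENNReal.ofReal_mul hA]
    refine mul_le_mul' (ENNReal.rpow_le_rpow (ENNReal.ofReal_le_ofReal ?_) hq.le) le_rfl
    calc t ^ (-θ) * Kfun E F NE NF (T f) t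
        ≤ t ^ (-θ) * (M₀ * Kfun E F NE NF f (M₁ / M₀ * t)) := by
          gcongr
          exact Kfun_map_le hNE.nonneg hNF.nonneg T hTE hTF hM₀ hTboundE hTboundF hf ht.le
      _ = M₀ ^ (1 - θ) * M₁ ^ θ *
          ((M₁ / M₀ * t) ^ (-θ) * Kfun E F NE NF f (M₁ / M₀ * t)) := by
          rw [Real.mul_rpow hc.le ht.le]
          linear_combination (-(t ^ (-θ) * Kfun E F NE NF f (M₁ / M₀ * t))) * hconst
  calc qInt (Kfun E F NE NF (T f)) (-θ) q ^ (1 / q)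
      ≤ (ENNReal.ofReal (M₀ ^ (1 - θ) * M₁ ^ θ) ^ q *
          qInt (Kfun E F NE NF f) (-θ) q) ^ (1 / q) := by gcongr
    _ = _ := by
      rw [ENNReal.mul_rpow_of_nonneg _ _ (by positivity), ← ENNReal.rpow_mul,
        mul_one_div_cancel hq.ne', ENNReal.rpow_one]
end

section
/- (Reiteration theorem, K-part.) Let E, F be linear subspaces of a real vector space, each with a quasi-norm, and let E₀, E₁ be complete quasi-normed linear spaces intermediate between E and F (i.e. E ∩ F ⊆ E_i ⊆ E + F with continuous inclusions). Suppose there exist constants C > 0 and exponents 0 ≤ θ₀, θ₁ ≤ 1 with θ₀ ≠ θ₁ such that K(f,t,E,F) ≤ C · t^{θ_i} · ‖f‖_{E_i} for all f ∈ E_i, all t > 0, and i = 0, 1. Then for every 0 < η < 1 and 0 < q < ∞, setting θ = (1−η)θ₀ + ηθ₁, there exists C′ > 0 such that for all f ∈ E₀ + E₁: (∫₀^∞ (t^{−θ} K(f,t,E,F))^q dt/t)^{1/q} ≤ C′ · (∫₀^∞ (t^{−η} K(f,t,E₀,E₁))^q dt/t)^{1/q}. -/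
open MeasureTheory Set Filter
open scoped ENNReal

variable {V : Type*} [AddCommGroup V] [Module ℝ V]

theorem Kfun_le_of_eq_add {A B : Submodule ℝ V} {NA NB : V → ℝ} (hA : IsQuasiNorm A NA)
    (hB : IsQuasiNorm B NB) {t : ℝ} (ht : 0 ≤ t) {f f₀ f₁ : V} (h₀ : f₀ ∈ A) (h₁ : f₁ ∈ B)
    (hf : f = f₀ + f₁) : Kfun A B NA NB f t ≤ NA f₀ + t * NB f₁ := by
  refine csInf_le ⟨0, ?_⟩ ⟨f₀, h₀, f₁, h₁, hf, rfl⟩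
  rintro x ⟨g₀, hg₀, g₁, hg₁, -, rfl⟩
  exact add_nonneg (hA.nonneg _ hg₀) (mul_nonneg ht (hB.nonneg _ hg₁))

theorem le_Kfun {A B : Submodule ℝ V} {NA NB : V → ℝ} {t c : ℝ} {f : V} (hf : f ∈ A ⊔ B)
    (h : ∀ f₀ ∈ A, ∀ f₁ ∈ B, f = f₀ + f₁ → c ≤ NA f₀ + t * NB f₁) :
    c ≤ Kfun A B NA NB f t := by
  obtain ⟨g₀, hg₀, g₁, hg₁, hg⟩ := Submodule.mem_sup.1 hf
  refine le_csInf ⟨_, g₀, hg₀, g₁, hg₁, hg.symm, rfl⟩ ?_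
  rintro x ⟨f₀, h₀, f₁, h₁, hf, rfl⟩
  exact h f₀ h₀ f₁ h₁ hf

/-- The K-functional of a quasi-normed pair satisfies a quasi-triangle inequality, with a constant
independent of `t`. -/
theorem exists_Kfun_add_le {A B : Submodule ℝ V} {NA NB : V → ℝ} (hA : IsQuasiNorm A NA)
    (hB : IsQuasiNorm B NB) :
    ∃ M : ℝ, 0 < M ∧ ∀ f ∈ A ⊔ B, ∀ g ∈ A ⊔ B, ∀ t : ℝ, 0 ≤ t →
      Kfun A B NA NB (f + g) t ≤ M * (Kfun A B NA NB f t + Kfun A B NA NB g t) := by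
  obtain ⟨a, ha, hA'⟩ := hA.triangle
  obtain ⟨b, hb, hB'⟩ := hB.triangle
  have hM : 0 < max a b := lt_of_lt_of_le (by linarith) (le_max_left a b)
  refine ⟨max a b, hM, fun f hf g hg t ht => ?_⟩
  rw [← div_le_iff₀' hM, ← sub_le_iff_le_add]
  refine le_Kfun hf fun f₀ hf₀ f₁ hf₁ hfe => ?_
  rw [sub_le_comm]
  refine le_Kfun hg fun g₀ hg₀ g₁ hg₁ hge => ?_
  rw [sub_le_iff_le_add, div_le_iff₀' hM]
  have hsum : f + g = (f₀ + g₀) + (f₁ + g₁) := by rw [hfe, hge]; abel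
  refine (Kfun_le_of_eq_add hA hB ht (A.add_mem hf₀ hg₀) (B.add_mem hf₁ hg₁) hsum).trans ?_
  have h₀ : NA (f₀ + g₀) ≤ max a b * (NA f₀ + NA g₀) :=
    (hA' _ hf₀ _ hg₀).trans (mul_le_mul_of_nonneg_right (le_max_left _ _)
      (add_nonneg (hA.nonneg _ hf₀) (hA.nonneg _ hg₀)))
  have h₁ : NB (f₁ + g₁) ≤ max a b * (NB f₁ + NB g₁) :=
    (hB' _ hf₁ _ hg₁).trans (mul_le_mul_of_nonneg_right (le_max_right _ _)
      (add_nonneg (hB.nonneg _ hf₁) (hB.nonneg _ hg₁)))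
  linarith [mul_le_mul_of_nonneg_left h₁ ht]

/-- The pointwise form of reiteration: the K-functional of `(E, F)` is controlled by that of a
pair of spaces of classes `𝒦(θ₀)` and `𝒦(θ₁)`. -/
theorem exists_Kfun_le_rpow_mul_Kfun {E F S₀ S₁ : Submodule ℝ V} {NE NF N₀ N₁ : V → ℝ}
    (hNE : IsQuasiNorm E NE) (hNF : IsQuasiNorm F NF) (h₀ : S₀ ≤ E ⊔ F) (h₁ : S₁ ≤ E ⊔ F)
    {C θ₀ θ₁ : ℝ} (hC : 0 < C)
    (hK₀ : ∀ f ∈ S₀, ∀ t : ℝ, 0 < t → Kfun E F NE NF f t ≤ C * t ^ θ₀ * N₀ f)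
    (hK₁ : ∀ f ∈ S₁, ∀ t : ℝ, 0 < t → Kfun E F NE NF f t ≤ C * t ^ θ₁ * N₁ f) :
    ∃ D : ℝ, 0 < D ∧ ∀ f ∈ S₀ ⊔ S₁, ∀ t : ℝ, 0 < t →
      Kfun E F NE NF f t ≤ D * t ^ θ₀ * Kfun S₀ S₁ N₀ N₁ f (t ^ (θ₁ - θ₀)) := by
  obtain ⟨M, hM, hadd⟩ := exists_Kfun_add_le hNE hNF
  refine ⟨M * C, mul_pos hM hC, fun f hf t ht => ?_⟩
  have hpos : 0 < M * C * t ^ θ₀ := by positivity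
  rw [← div_le_iff₀' hpos]
  refine le_Kfun hf fun f₀ hf₀ f₁ hf₁ hfe => ?_
  rw [div_le_iff₀' hpos, hfe]
  calc Kfun E F NE NF (f₀ + f₁) t
      ≤ M * (Kfun E F NE NF f₀ t + Kfun E F NE NF f₁ t) := hadd _ (h₀ hf₀) _ (h₁ hf₁) t ht.le
    _ ≤ M * (C * t ^ θ₀ * N₀ f₀ + C * t ^ θ₁ * N₁ f₁) := by
        gcongr
        exacts [hK₀ _ hf₀ t ht, hK₁ _ hf₁ t ht]
    _ = M * C * t ^ θ₀ * (N₀ f₀ + t ^ (θ₁ - θ₀) * N₁ f₁) := by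
        rw [show t ^ θ₁ = t ^ θ₀ * t ^ (θ₁ - θ₀) by rw [← Real.rpow_add ht]; ring_nf]
        ring

/-- The Haar measure `dt/t` on `(0, ∞)` is scaled by `|a|⁻¹` under `t ↦ t ^ a`. -/
theorem lintegral_Ioi_comp_rpow_mul_inv {a : ℝ} (ha : a ≠ 0) (G : ℝ → ℝ≥0∞) :
    ∫⁻ t in Ioi (0 : ℝ), G (t ^ a) * ENNReal.ofReal t⁻¹ =
      ENNReal.ofReal |a|⁻¹ * ∫⁻ s in Ioi (0 : ℝ), G s * ENNReal.ofReal s⁻¹ := by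
  have himage : (fun t : ℝ => t ^ a) '' Ioi 0 = Ioi 0 := by
    ext s
    refine ⟨?_, fun hs => ⟨s ^ a⁻¹, Real.rpow_pos_of_pos hs _, Real.rpow_inv_rpow hs.le ha⟩⟩
    rintro ⟨t, ht, rfl⟩
    exact Real.rpow_pos_of_pos ht _
  have hinj : InjOn (fun t : ℝ => t ^ a) (Ioi 0) :=
    (Real.rpow_left_injOn ha).mono fun t (ht : 0 < t) => ht.le
  have hderiv : ∀ t ∈ Ioi (0 : ℝ),
      HasDerivWithinAt (fun t : ℝ => t ^ a) (a * t ^ (a - 1)) (Ioi 0) t := fun t ht =>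
    (Real.hasDerivAt_rpow_const (Or.inl (ne_of_gt ht))).hasDerivWithinAt
  have hcov := lintegral_image_eq_lintegral_abs_deriv_mul measurableSet_Ioi hderiv hinj
    fun s => G s * ENNReal.ofReal s⁻¹
  rw [himage] at hcov
  rw [hcov, ← lintegral_const_mul' _ _ ENNReal.ofReal_ne_top]
  refine setLIntegral_congr_fun measurableSet_Ioi fun t ht => ?_
  have ht : 0 < t := ht
  have hjac : t⁻¹ = |a|⁻¹ * (|a * t ^ (a - 1)| * (t ^ a)⁻¹) := by
    have hta : t ^ a ≠ 0 := (Real.rpow_pos_of_pos ht a).ne'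
    have ha' : |a| ≠ 0 := abs_ne_zero.2 ha
    rw [abs_mul, abs_of_pos (Real.rpow_pos_of_pos ht _), Real.rpow_sub_one ht.ne']
    field_simp
  rw [hjac, ENNReal.ofReal_mul (by positivity), ENNReal.ofReal_mul (abs_nonneg _)]
  ring

theorem qInt_le_of_le_mul_comp_rpow {g h : ℝ → ℝ} {D a e e' q : ℝ} (hD : 0 ≤ D) (ha : a ≠ 0)
    (hq : 0 ≤ q) (hgh : ∀ t : ℝ, 0 < t → t ^ e * g t ≤ D * ((t ^ a) ^ e' * h (t ^ a))) :
    qInt g e q ≤ ENNReal.ofReal D ^ q * (ENNReal.ofReal |a|⁻¹ * qInt h e' q) := by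
  unfold qInt
  rw [← lintegral_Ioi_comp_rpow_mul_inv ha fun s => ENNReal.ofReal (s ^ e' * h s) ^ q,
    ← lintegral_const_mul' _ _ (ENNReal.rpow_ne_top_of_nonneg hq ENNReal.ofReal_ne_top)]
  refine setLIntegral_mono' measurableSet_Ioi fun t ht => ?_
  rw [← mul_assoc, ← ENNReal.mul_rpow_of_nonneg _ _ hq, ← ENNReal.ofReal_mul hD]
  gcongr ENNReal.ofReal ?_ ^ q * _
  exact hgh t ht

/-- **Reiteration theorem, K-part.** If `E₀, E₁` are complete intermediate spaces for the
pair `(E,F)` of class `𝒦(θᵢ; E, F)`, i.e. `K(f,t,E,F) ≤ C t^{θᵢ} ‖f‖_{Eᵢ}`, then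
`(E₀,E₁)^K_{η,q} ⊆ (E,F)^K_{θ,q}` with `θ = (1−η)θ₀ + ηθ₁`. -/
theorem reiteration_K_part
    (E F : Submodule ℝ V) (NE NF : V → ℝ)
    (hNE : IsQuasiNorm E NE) (hNF : IsQuasiNorm F NF)
    (S₀ S₁ : Submodule ℝ V) (N₀ N₁ : V → ℝ)
    (hN₀ : IsQuasiNorm S₀ N₀) (hN₁ : IsQuasiNorm S₁ N₁)
    (hcomp₀ : QComplete S₀ N₀) (hcomp₁ : QComplete S₁ N₁)
    -- `E ∩ F ⊆ Eᵢ ⊆ E + F` with continuous inclusions (the quasi-norm on `E ∩ F` is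
    -- `max(‖·‖_E, ‖·‖_F)` and the quasi-norm on `E + F` is `K(·, 1, E, F)`):
    (hsub₀ : E ⊓ F ≤ S₀) (hsub₀' : S₀ ≤ E ⊔ F)
    (hsub₁ : E ⊓ F ≤ S₁) (hsub₁' : S₁ ≤ E ⊔ F)
    (hcont₀ : ∃ c : ℝ, 0 < c ∧ ∀ f ∈ E ⊓ F, N₀ f ≤ c * max (NE f) (NF f))
    (hcont₀' : ∃ c : ℝ, 0 < c ∧ ∀ f ∈ S₀, Kfun E F NE NF f 1 ≤ c * N₀ f)
    (hcont₁ : ∃ c : ℝ, 0 < c ∧ ∀ f ∈ E ⊓ F, N₁ f ≤ c * max (NE f) (NF f))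
    (hcont₁' : ∃ c : ℝ, 0 < c ∧ ∀ f ∈ S₁, Kfun E F NE NF f 1 ≤ c * N₁ f)
    (C θ₀ θ₁ : ℝ) (hC : 0 < C)
    (hθ₀ : 0 ≤ θ₀) (hθ₀' : θ₀ ≤ 1) (hθ₁ : 0 ≤ θ₁) (hθ₁' : θ₁ ≤ 1) (hne : θ₀ ≠ θ₁)
    (hK₀ : ∀ f ∈ S₀, ∀ t : ℝ, 0 < t → Kfun E F NE NF f t ≤ C * t ^ θ₀ * N₀ f)
    (hK₁ : ∀ f ∈ S₁, ∀ t : ℝ, 0 < t → Kfun E F NE NF f t ≤ C * t ^ θ₁ * N₁ f)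
    (η q : ℝ) (hη₀ : 0 < η) (hη₁ : η < 1) (hq : 0 < q) :
    ∃ C' : ℝ, 0 < C' ∧ ∀ f ∈ S₀ ⊔ S₁,
      (qInt (Kfun E F NE NF f) (-((1 - η) * θ₀ + η * θ₁)) q) ^ (1 / q) ≤
        ENNReal.ofReal C' * (qInt (Kfun S₀ S₁ N₀ N₁ f) (-η) q) ^ (1 / q) := by
  obtain ⟨D, hD, hle⟩ := exists_Kfun_le_rpow_mul_Kfun hNE hNF hsub₀' hsub₁' hC hK₀ hK₁
  have ha : θ₁ - θ₀ ≠ 0 := sub_ne_zero.2 hne.symm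
  have ha' : 0 < |θ₁ - θ₀|⁻¹ := inv_pos.2 (abs_pos.2 ha)
  refine ⟨D * |θ₁ - θ₀|⁻¹ ^ (1 / q), by positivity, fun f hf => ?_⟩
  have hint : qInt (Kfun E F NE NF f) (-((1 - η) * θ₀ + η * θ₁)) q ≤
      ENNReal.ofReal D ^ q *
        (ENNReal.ofReal |θ₁ - θ₀|⁻¹ * qInt (Kfun S₀ S₁ N₀ N₁ f) (-η) q) := by
    refine qInt_le_of_le_mul_comp_rpow hD.le ha hq.le fun t ht => ?_
    have hexp : t ^ (-((1 - η) * θ₀ + η * θ₁)) * t ^ θ₀ = (t ^ (θ₁ - θ₀)) ^ (-η) := by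
      rw [← Real.rpow_add ht, ← Real.rpow_mul ht.le]
      ring_nf
    refine (mul_le_mul_of_nonneg_left (hle f hf t ht) (by positivity)).trans_eq ?_
    rw [← hexp]
    ring
  have hq' : 0 ≤ 1 / q := by positivity
  refine (ENNReal.rpow_le_rpow hint hq').trans_eq ?_
  rw [ENNReal.mul_rpow_of_nonneg _ _ hq', ENNReal.mul_rpow_of_nonneg _ _ hq', ← ENNReal.rpow_mul,
    mul_one_div_cancel hq.ne', ENNReal.rpow_one, ENNReal.ofReal_mul hD.le,
    ENNReal.ofReal_rpow_of_pos ha', mul_assoc]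
end

section
/- (Equivalence of approximation and interpolation spaces.) Let F ⊆ E be linear subspaces of a real vector space, each with a quasi-norm, let α > 0, 0 < q < ∞, and set θ = 1/(α+1). Then there exist constants c, C > 0 such that for every f ∈ E: c · (∫₀^∞ (t^{−θ} K(f,t,F,E))^{q/θ} dt/t)^{θ/q} ≤ (∫₀^∞ (t^{α} 𝓔(f,t))^{q} dt/t)^{θ/q} ≤ C · (∫₀^∞ (t^{−θ} K(f,t,F,E))^{q/θ} dt/t)^{θ/q}, where 𝓔(f,t) = inf{‖f−g‖_E : g ∈ F, ‖g‖_F ≤ t} and K(f,t,F,E) = inf{‖f₀‖_F + t‖f₁‖_E : f = f₀ + f₁, f₀ ∈ F, f₁ ∈ E} (with the convention that the quantities are simultaneously finite or infinite). In particular, the θ-th power of the approximation space 𝓔_{α,q}(E,F) coincides with the interpolation space (F,E)^K_{θ,q/θ}. -/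
open MeasureTheory Set Filter
open scoped ENNReal

variable {V : Type*} [AddCommGroup V] [Module ℝ V]

lemma lintegral_Ioc_rpow_sub_one {p b : ℝ} (hp : 0 < p) (hb : 0 ≤ b) :
    ∫⁻ s in Ioc 0 b, ENNReal.ofReal (s ^ (p - 1)) = ENNReal.ofReal (b ^ p / p) := by
  have hint : IntervalIntegrable (fun s : ℝ => s ^ (p - 1)) volume 0 b :=
    intervalIntegral.intervalIntegrable_rpow' (by linarith)
  rw [intervalIntegrable_iff_integrableOn_Ioc_of_le hb] at hint
  rw [← ofReal_integral_eq_lintegral_ofReal hint, ← intervalIntegral.integral_of_le hb,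
    integral_rpow (Or.inl (by linarith))]
  · simp [Real.zero_rpow hp.ne']
  · filter_upwards [ae_restrict_mem measurableSet_Ioc] with s hs
    exact Real.rpow_nonneg hs.1.le _

lemma lintegral_Ici_rpow_neg_sub_one {q a : ℝ} (hq : 0 < q) (ha : 0 < a) :
    ∫⁻ t in Ici a, ENNReal.ofReal (t ^ (-q - 1)) = ENNReal.ofReal (a ^ (-q) / q) := by
  rw [setLIntegral_congr Ioi_ae_eq_Ici.symm, ← ofReal_integral_eq_lintegral_ofReal
    (integrableOn_Ioi_rpow_of_lt (by linarith) ha), integral_Ioi_rpow_of_lt (by linarith) ha]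
  · congr 1
    rw [sub_add_cancel, neg_div_neg_eq]
  · filter_upwards [ae_restrict_mem measurableSet_Ioi] with t ht
    exact Real.rpow_nonneg (ha.trans ht).le _

lemma qInt_eq_lintegral {g : ℝ → ℝ} (hg : ∀ t, 0 < t → 0 ≤ g t) (e : ℝ) {q : ℝ} (hq : 0 < q) :
    qInt g e q = ∫⁻ t in Ioi (0 : ℝ), ENNReal.ofReal (t ^ (e * q - 1) * g t ^ q) := by
  refine setLIntegral_congr_fun measurableSet_Ioi fun t (ht : 0 < t) => ?_
  have h := Real.rpow_nonneg ht.le e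
  rw [ENNReal.ofReal_rpow_of_nonneg (mul_nonneg h (hg t ht)) hq.le,
    ← ENNReal.ofReal_mul (Real.rpow_nonneg (mul_nonneg h (hg t ht)) _),
    Real.mul_rpow h (hg t ht), ← Real.rpow_mul ht.le, Real.rpow_sub_one ht.ne']
  congr 1
  field_simp

/-- Integrating `s ^ (p - 1) * t ^ (-q - 1)` over the region `{s ≤ t * e s}`, first in `t`. -/
lemma lintegral_region_eq {e : ℝ → ℝ} (he : ∀ s, 0 < s → 0 ≤ e s) {p q : ℝ} (hq : 0 < q) :
    ∫⁻ s in Ioi (0 : ℝ), ∫⁻ t in Ioi (0 : ℝ), {x : ℝ × ℝ | x.1 ≤ x.2 * e x.1}.indicator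
      (fun x => ENNReal.ofReal (x.1 ^ (p - 1)) * ENNReal.ofReal (x.2 ^ (-q - 1))) (s, t) =
    ENNReal.ofReal q⁻¹ * ∫⁻ s in Ioi (0 : ℝ), ENNReal.ofReal (s ^ (p - q - 1) * e s ^ q) := by
  rw [← lintegral_const_mul' _ _ ENNReal.ofReal_ne_top]
  refine setLIntegral_congr_fun measurableSet_Ioi fun s (hs : 0 < s) => ?_
  rcases (he s hs).eq_or_lt with h0 | h0
  · simp [indicator, ← h0, hs.not_ge, Real.zero_rpow hq.ne']
  have ha : 0 < s / e s := div_pos hs h0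
  have hind : ∀ t, {x : ℝ × ℝ | x.1 ≤ x.2 * e x.1}.indicator
      (fun x => ENNReal.ofReal (x.1 ^ (p - 1)) * ENNReal.ofReal (x.2 ^ (-q - 1))) (s, t) =
      (Ici (s / e s)).indicator
        (fun t => ENNReal.ofReal (s ^ (p - 1)) * ENNReal.ofReal (t ^ (-q - 1))) t := by
    intro t
    simp only [indicator, mem_ofPred_eq, mem_Ici, div_le_iff₀ h0]
  simp_rw [hind]
  rw [setLIntegral_indicator measurableSet_Ici,
    inter_eq_self_of_subset_left (Ici_subset_Ioi.2 ha),
    lintegral_const_mul' _ _ ENNReal.ofReal_ne_top, lintegral_Ici_rpow_neg_sub_one hq ha,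
    ← ENNReal.ofReal_mul (Real.rpow_nonneg hs.le _), ← ENNReal.ofReal_mul (inv_pos.2 hq).le]
  congr 1
  rw [Real.rpow_neg ha.le, Real.div_rpow hs.le h0.le, show p - q - 1 = p - 1 - q by ring,
    Real.rpow_sub hs (p - 1) q]
  have := (Real.rpow_pos_of_pos h0 q).ne'
  have := (Real.rpow_pos_of_pos hs q).ne'
  field_simp

lemma lintegral_region_swap {e : ℝ → ℝ} (he : Measurable e) (p q : ℝ) :
    ∫⁻ s in Ioi (0 : ℝ), ∫⁻ t in Ioi (0 : ℝ), {x : ℝ × ℝ | x.1 ≤ x.2 * e x.1}.indicator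
      (fun x => ENNReal.ofReal (x.1 ^ (p - 1)) * ENNReal.ofReal (x.2 ^ (-q - 1))) (s, t) =
    ∫⁻ t in Ioi (0 : ℝ), ∫⁻ s in Ioi (0 : ℝ), {x : ℝ × ℝ | x.1 ≤ x.2 * e x.1}.indicator
      (fun x => ENNReal.ofReal (x.1 ^ (p - 1)) * ENNReal.ofReal (x.2 ^ (-q - 1))) (s, t) := by
  refine lintegral_lintegral_swap (Measurable.aemeasurable ?_)
  refine Measurable.indicator (by fun_prop) ?_
  exact measurableSet_le (by fun_prop) (by fun_prop)

lemma setLIntegral_mul_indicator_Ioc {p b : ℝ} (hp : 0 < p) (hb : 0 ≤ b) {r : ℝ≥0∞} (hr : r ≠ ⊤) :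
    ∫⁻ s in Ioi (0 : ℝ), (Ioc 0 b).indicator (fun s => ENNReal.ofReal (s ^ (p - 1)) * r) s =
      ENNReal.ofReal (b ^ p / p) * r := by
  rw [setLIntegral_indicator measurableSet_Ioc, inter_eq_self_of_subset_left Ioc_subset_Ioi_self,
    lintegral_mul_const' _ _ hr, lintegral_Ioc_rpow_sub_one hp hb]

/-- If `s ≤ t * e s` forces `s ≤ K t`, a weighted integral of `e` is bounded by one of `K`. -/
lemma lintegral_le_of_le_imp {e K : ℝ → ℝ} (hem : Measurable e) (he : ∀ s, 0 < s → 0 ≤ e s)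
    (hK : ∀ t, 0 < t → 0 ≤ K t) (h : ∀ s t, 0 < s → 0 < t → s ≤ t * e s → s ≤ K t)
    {p q : ℝ} (hp : 0 < p) (hq : 0 < q) :
    ∫⁻ s in Ioi (0 : ℝ), ENNReal.ofReal (s ^ (p - q - 1) * e s ^ q) ≤
      ENNReal.ofReal (q / p) * ∫⁻ t in Ioi (0 : ℝ), ENNReal.ofReal (t ^ (-q - 1) * K t ^ p) := by
  have key : ENNReal.ofReal q⁻¹ *
      ∫⁻ s in Ioi (0 : ℝ), ENNReal.ofReal (s ^ (p - q - 1) * e s ^ q) ≤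
      ENNReal.ofReal p⁻¹ * ∫⁻ t in Ioi (0 : ℝ), ENNReal.ofReal (t ^ (-q - 1) * K t ^ p) := by
    rw [← lintegral_region_eq he hq, lintegral_region_swap hem,
      ← lintegral_const_mul' _ _ ENNReal.ofReal_ne_top]
    refine setLIntegral_mono' measurableSet_Ioi fun t (ht : 0 < t) => ?_
    calc _ ≤ ∫⁻ s in Ioi (0 : ℝ), (Ioc 0 (K t)).indicator
          (fun s => ENNReal.ofReal (s ^ (p - 1)) * ENNReal.ofReal (t ^ (-q - 1))) s := by
          refine setLIntegral_mono' measurableSet_Ioi fun s (hs : 0 < s) => ?_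
          by_cases hst : s ≤ t * e s
          · simp [indicator, hst, hs, h s t hs ht hst]
          · simp [indicator, hst]
      _ = _ := by
          rw [setLIntegral_mul_indicator_Ioc hp (hK t ht) ENNReal.ofReal_ne_top,
            ← ENNReal.ofReal_mul (div_nonneg (Real.rpow_nonneg (hK t ht) _) hp.le),
            ← ENNReal.ofReal_mul (inv_pos.2 hp).le]
          congr 1
          ring
  calc _ = ENNReal.ofReal q * (ENNReal.ofReal q⁻¹ *
        ∫⁻ s in Ioi (0 : ℝ), ENNReal.ofReal (s ^ (p - q - 1) * e s ^ q)) := by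
        rw [← mul_assoc, ← ENNReal.ofReal_mul hq.le, mul_inv_cancel₀ hq.ne', ENNReal.ofReal_one,
          one_mul]
    _ ≤ _ := by
        rw [div_eq_mul_inv, ENNReal.ofReal_mul hq.le, mul_assoc]
        gcongr

/-- If `2 * s < K t` forces `s ≤ t * e s`, a weighted integral of `K` is bounded by one of `e`. -/
lemma lintegral_le_of_lt_imp {e K : ℝ → ℝ} (hem : Measurable e) (he : ∀ s, 0 < s → 0 ≤ e s)
    (hK : ∀ t, 0 < t → 0 ≤ K t) (h : ∀ s t, 0 < s → 0 < t → 2 * s < K t → s ≤ t * e s)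
    {p q : ℝ} (hp : 0 < p) (hq : 0 < q) :
    ∫⁻ t in Ioi (0 : ℝ), ENNReal.ofReal (t ^ (-q - 1) * K t ^ p) ≤
      ENNReal.ofReal (2 ^ p * (p / q)) *
        ∫⁻ s in Ioi (0 : ℝ), ENNReal.ofReal (s ^ (p - q - 1) * e s ^ q) := by
  have key : ENNReal.ofReal (2 ^ p * p)⁻¹ *
      ∫⁻ t in Ioi (0 : ℝ), ENNReal.ofReal (t ^ (-q - 1) * K t ^ p) ≤
      ENNReal.ofReal q⁻¹ *
        ∫⁻ s in Ioi (0 : ℝ), ENNReal.ofReal (s ^ (p - q - 1) * e s ^ q) := by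
    rw [← lintegral_region_eq he hq, lintegral_region_swap hem,
      ← lintegral_const_mul' _ _ ENNReal.ofReal_ne_top]
    refine setLIntegral_mono' measurableSet_Ioi fun t (ht : 0 < t) => ?_
    have hK2 : 0 ≤ K t / 2 := div_nonneg (hK t ht) two_pos.le
    calc _ = ∫⁻ s in Ioi (0 : ℝ), (Ioc 0 (K t / 2)).indicator
          (fun s => ENNReal.ofReal (s ^ (p - 1)) * ENNReal.ofReal (t ^ (-q - 1))) s := by
          rw [setLIntegral_mul_indicator_Ioc hp hK2 ENNReal.ofReal_ne_top,
            ← ENNReal.ofReal_mul (div_nonneg (Real.rpow_nonneg hK2 _) hp.le),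
            ← ENNReal.ofReal_mul (by positivity), Real.div_rpow (hK t ht) two_pos.le]
          congr 1
          field_simp
      _ ≤ _ := by
          refine lintegral_mono_ae ?_
          filter_upwards [ae_restrict_mem measurableSet_Ioi,
            ae_restrict_of_ae (Measure.ae_ne volume (K t / 2))] with s hs hne
          by_cases hsK : s ≤ K t / 2
          · have hlt : s < K t / 2 := lt_of_le_of_ne hsK hne
            simp [indicator, hsK, mem_Ioi.1 hs, h s t hs ht (by linarith)]
          · simp [indicator, hsK]
  calc _ = ENNReal.ofReal (2 ^ p * p) * (ENNReal.ofReal (2 ^ p * p)⁻¹ *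
        ∫⁻ t in Ioi (0 : ℝ), ENNReal.ofReal (t ^ (-q - 1) * K t ^ p)) := by
        rw [← mul_assoc, ← ENNReal.ofReal_mul (by positivity), mul_inv_cancel₀ (by positivity),
          ENNReal.ofReal_one, one_mul]
    _ ≤ _ := by
        rw [← mul_div_assoc, div_eq_mul_inv, ENNReal.ofReal_mul (p := 2 ^ p * p) (by positivity),
          mul_assoc]
        gcongr

section Functionals

variable {F E : Submodule ℝ V} {NF NE : V → ℝ} {f : V}

lemma Efun_nonneg (hFE : F ≤ E) (hNE : IsQuasiNorm E NE) (hf : f ∈ E) (t : ℝ) :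
    0 ≤ Efun E F NE NF f t := by
  refine Real.sInf_nonneg ?_
  rintro _ ⟨g, hg, -, rfl⟩
  exact hNE.nonneg _ (E.sub_mem hf (hFE hg))

lemma Efun_le (hFE : F ≤ E) (hNE : IsQuasiNorm E NE) (hf : f ∈ E) {t : ℝ} {g : V} (hg : g ∈ F)
    (hgt : NF g ≤ t) : Efun E F NE NF f t ≤ NE (f - g) := by
  refine csInf_le ⟨0, ?_⟩ ⟨g, hg, hgt, rfl⟩
  rintro _ ⟨g, hg, -, rfl⟩
  exact hNE.nonneg _ (E.sub_mem hf (hFE hg))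

lemma exists_NE_sub_lt_of_Efun_lt (hNF : IsQuasiNorm F NF) {t x : ℝ} (ht : 0 ≤ t)
    (hx : Efun E F NE NF f t < x) : ∃ g ∈ F, NF g ≤ t ∧ NE (f - g) < x := by
  have hne : {x : ℝ | ∃ g ∈ F, NF g ≤ t ∧ x = NE (f - g)}.Nonempty :=
    ⟨_, 0, F.zero_mem, ((hNF.eq_zero_iff 0 F.zero_mem).2 rfl).trans_le ht, rfl⟩
  obtain ⟨_, ⟨g, hg, hgt, rfl⟩, hlt⟩ := exists_lt_of_csInf_lt hne hx
  exact ⟨g, hg, hgt, hlt⟩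

lemma measurable_Efun (hFE : F ≤ E) (hNF : IsQuasiNorm F NF) (hNE : IsQuasiNorm E NE)
    (hf : f ∈ E) : Measurable (Efun E F NE NF f) := by
  have hanti : Antitone fun t => Efun E F NE NF f (max t 0) := by
    intro s t hst
    refine le_of_forall_gt fun x hx => ?_
    obtain ⟨g, hg, hgs, hlt⟩ := exists_NE_sub_lt_of_Efun_lt hNF (le_max_right s 0) hx
    exact (Efun_le hFE hNE hf hg (hgs.trans (max_le_max_right 0 hst))).trans_lt hlt
  convert hanti.measurable.indicator (measurableSet_Ici (a := (0 : ℝ))) using 1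
  funext t
  by_cases ht : 0 ≤ t
  · simp [indicator, ht]
  · have hempty : {x : ℝ | ∃ g ∈ F, NF g ≤ t ∧ x = NE (f - g)} = ∅ := by
      refine eq_empty_of_forall_notMem ?_
      rintro _ ⟨g, hg, hgt, -⟩
      exact ht ((hNF.nonneg g hg).trans hgt)
    simp [indicator, ht, Efun, hempty]

lemma le_Kfun_s6 (hf : f ∈ E) {t x : ℝ} (hx : ∀ g ∈ F, x ≤ NF g + t * NE (f - g)) :
    x ≤ Kfun F E NF NE f t := by
  refine le_csInf ⟨_, 0, F.zero_mem, f, hf, (zero_add f).symm, rfl⟩ ?_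
  rintro _ ⟨g, hg, f₁, -, rfl, rfl⟩
  simpa using hx g hg

lemma Kfun_nonneg (hNF : IsQuasiNorm F NF) (hNE : IsQuasiNorm E NE) {t : ℝ} (ht : 0 ≤ t) :
    0 ≤ Kfun F E NF NE f t := by
  refine Real.sInf_nonneg ?_
  rintro _ ⟨g, hg, f₁, hf₁, -, rfl⟩
  exact add_nonneg (hNF.nonneg g hg) (mul_nonneg ht (hNE.nonneg f₁ hf₁))

lemma Kfun_le_s6 (hFE : F ≤ E) (hNF : IsQuasiNorm F NF) (hNE : IsQuasiNorm E NE) (hf : f ∈ E)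
    {t : ℝ} (ht : 0 ≤ t) {g : V} (hg : g ∈ F) :
    Kfun F E NF NE f t ≤ NF g + t * NE (f - g) := by
  refine csInf_le ⟨0, ?_⟩
    ⟨g, hg, f - g, E.sub_mem hf (hFE hg), (add_sub_cancel g f).symm, rfl⟩
  rintro _ ⟨g, hg, f₁, hf₁, -, rfl⟩
  exact add_nonneg (hNF.nonneg g hg) (mul_nonneg ht (hNE.nonneg f₁ hf₁))

lemma le_Kfun_of_le_mul_Efun (hFE : F ≤ E) (hNF : IsQuasiNorm F NF) (hNE : IsQuasiNorm E NE)
    (hf : f ∈ E) {s t : ℝ} (ht : 0 ≤ t) (hst : s ≤ t * Efun E F NE NF f s) :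
    s ≤ Kfun F E NF NE f t := by
  refine le_Kfun_s6 hf fun g hg => ?_
  rcases le_total (NF g) s with h | h
  · have := mul_le_mul_of_nonneg_left (Efun_le hFE hNE hf hg h) ht
    linarith [hNF.nonneg g hg]
  · have := mul_nonneg ht (hNE.nonneg _ (E.sub_mem hf (hFE hg)))
    linarith

lemma le_mul_Efun_of_lt_Kfun (hFE : F ≤ E) (hNF : IsQuasiNorm F NF) (hNE : IsQuasiNorm E NE)
    (hf : f ∈ E) {s t : ℝ} (hs : 0 ≤ s) (ht : 0 < t) (hst : 2 * s < Kfun F E NF NE f t) :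
    s ≤ t * Efun E F NE NF f s := by
  by_contra! hlt
  rw [mul_comm, ← lt_div_iff₀ ht] at hlt
  obtain ⟨g, hg, hgs, hgt⟩ := exists_NE_sub_lt_of_Efun_lt hNF hs hlt
  rw [lt_div_iff₀ ht] at hgt
  linarith [Kfun_le_s6 hFE hNF hNE hf ht.le hg]

end Functionals

lemma ENNReal.rpow_le_ofReal_rpow_mul {x y : ℝ≥0∞} {a r : ℝ} (ha : 0 ≤ a) (hr : 0 ≤ r)
    (h : x ≤ ENNReal.ofReal a * y) : x ^ r ≤ ENNReal.ofReal (a ^ r) * y ^ r := by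
  rw [← ENNReal.ofReal_rpow_of_nonneg ha hr, ← ENNReal.mul_rpow_of_nonneg _ _ hr]
  exact ENNReal.rpow_le_rpow h hr

/-- **Equivalence of approximation and interpolation spaces.** For `θ = 1/(α+1)`, the
`θ`-th power of the approximation space `𝓔_{α,q}(E,F)` coincides (with equivalent
quasi-norms) with the interpolation space `(F,E)^K_{θ,q/θ}`. -/
theorem approximation_eq_interpolation
    (F E : Submodule ℝ V) (hFE : F ≤ E)
    (NF NE : V → ℝ)
    (hNF : IsQuasiNorm F NF) (hNE : IsQuasiNorm E NE)
    (α q θ : ℝ) (hα : 0 < α) (hq : 0 < q) (hθ : θ = 1 / (α + 1)) :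
    ∃ c C : ℝ, 0 < c ∧ 0 < C ∧ ∀ f ∈ E,
      ENNReal.ofReal c * (qInt (Kfun F E NF NE f) (-θ) (q / θ)) ^ (θ / q) ≤
          (qInt (Efun E F NE NF f) α q) ^ (θ / q) ∧
      (qInt (Efun E F NE NF f) α q) ^ (θ / q) ≤
          ENNReal.ofReal C * (qInt (Kfun F E NF NE f) (-θ) (q / θ)) ^ (θ / q) := by
  have hθ0 : 0 < θ := by rw [hθ]; positivity
  have hp : 0 < q / θ := div_pos hq hθ0
  have hr : 0 ≤ θ / q := (div_pos hθ0 hq).le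
  have hA : 0 < 2 ^ (q / θ) * (q / θ / q) := by positivity
  have hexpE : α * q - 1 = q / θ - q - 1 := by
    rw [hθ]; field_simp; ring
  have hexpK : -θ * (q / θ) - 1 = -q - 1 := by
    field_simp
  refine ⟨((2 ^ (q / θ) * (q / θ / q)) ^ (θ / q))⁻¹, (q / (q / θ)) ^ (θ / q), by positivity,
    by positivity, fun f hf => ?_⟩
  have hE0 : ∀ t, 0 < t → 0 ≤ Efun E F NE NF f t := fun t _ => Efun_nonneg hFE hNE hf t
  have hK0 : ∀ t, 0 < t → 0 ≤ Kfun F E NF NE f t := fun t ht => Kfun_nonneg hNF hNE ht.le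
  have hem := measurable_Efun hFE hNF hNE hf
  rw [qInt_eq_lintegral hE0 _ hq, qInt_eq_lintegral hK0 _ hp, hexpE, hexpK]
  constructor
  · have h := ENNReal.rpow_le_ofReal_rpow_mul hA.le hr <| lintegral_le_of_lt_imp hem hE0 hK0
      (fun s t hs ht => le_mul_Efun_of_lt_Kfun hFE hNF hNE hf hs.le ht) hp hq
    refine (mul_le_mul_right h _).trans_eq ?_
    rw [← mul_assoc, ← ENNReal.ofReal_mul (by positivity), inv_mul_cancel₀ (by positivity),
      ENNReal.ofReal_one, one_mul]
  · exact ENNReal.rpow_le_ofReal_rpow_mul (by positivity) hr <|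
      lintegral_le_of_le_imp hem hE0 hK0
        (fun s t _ ht => le_Kfun_of_le_mul_Efun hFE hNF hNE hf ht.le) hp hq
end

section
/- Let H be a complex Hilbert space, let A : H → H be a bounded self-adjoint linear operator, let f ∈ H and σ > 0. If there is a constant C(f,σ) < ∞ such that ‖A^k f‖ ≤ C(f,σ) · σ^k for every k ∈ ℕ, k ≥ 1, then in fact ‖A^k f‖ ≤ σ^k · ‖f‖ for every k ∈ ℕ, k ≥ 1; in particular sup_{k ≥ 1} σ^{−k}‖A^k f‖ ≤ ‖f‖. -/
/-- A nonnegative log-convex sequence that is `O(σ ^ k)` grows at each step by a factor of at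
most `σ`. -/
theorem le_mul_of_logConvex_of_le_geometric {u : ℕ → ℝ} (hu : ∀ k, 0 ≤ u k)
    (hconv : ∀ k, u (k + 1) ^ 2 ≤ u k * u (k + 2)) {σ C : ℝ} (hσ : 0 < σ)
    (hC : ∀ k, 1 ≤ k → u k ≤ C * σ ^ k) (n : ℕ) : u (n + 1) ≤ σ * u n := by
  by_contra! h
  have hn : 0 < u n := by
    refine (hu n).lt_of_ne fun h0 => ?_
    have := hconv n
    rw [← h0] at h this
    nlinarith
  obtain ⟨q, hq⟩ : ∃ q, u (n + 1) = q * u n := ⟨u (n + 1) / u n, by field_simp⟩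
  have hσq : σ < q := lt_of_mul_lt_mul_right (hq ▸ h) hn.le
  have hq0 : 0 < q := hσ.trans hσq
  have step (j : ℕ) : 0 < u (n + j) ∧ q * u (n + j) ≤ u (n + j + 1) := by
    induction j with
    | zero => exact ⟨hn, hq.ge⟩
    | succ j ih =>
      have hpos : 0 < u (n + j + 1) := (mul_pos hq0 ih.1).trans_le ih.2
      refine ⟨hpos, le_of_mul_le_mul_right ?_ hpos⟩
      calc q * u (n + j + 1) * u (n + j + 1) = q * u (n + j + 1) ^ 2 := by ring
        _ ≤ q * (u (n + j) * u (n + j + 2)) := by gcongr; exact hconv _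
        _ = q * u (n + j) * u (n + j + 2) := by ring
        _ ≤ u (n + j + 1) * u (n + j + 2) := mul_le_mul_of_nonneg_right ih.2 (hu _)
        _ = u (n + j + 2) * u (n + j + 1) := mul_comm _ _
  have growth (j : ℕ) : q ^ j * u n ≤ u (n + j) := by
    induction j with
    | zero => simp
    | succ j ih =>
      calc q ^ (j + 1) * u n = q * (q ^ j * u n) := by ring
        _ ≤ q * u (n + j) := by gcongr
        _ ≤ u (n + (j + 1)) := (step j).2
  have hratio : 1 < q / σ := (one_lt_div hσ).2 hσq
  obtain ⟨j, hj⟩ := pow_unbounded_of_one_lt (C * σ ^ n / u n) hratio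
  have hj' : C * σ ^ n / u n < (q / σ) ^ (j + 1) :=
    hj.trans (pow_lt_pow_right₀ hratio j.lt_succ_self)
  rw [div_pow, div_lt_div_iff₀ hn (pow_pos hσ _)] at hj'
  have hupper := (growth (j + 1)).trans (hC (n + (j + 1)) (by lia))
  rw [pow_add σ n, ← mul_assoc] at hupper
  exact absurd hupper hj'.not_ge

/-- The norms of the iterates of a self-adjoint operator form a log-convex sequence. -/
theorem IsSelfAdjoint.norm_pow_apply_sq_le {𝕜 E : Type*} [RCLike 𝕜] [NormedAddCommGroup E]
    [InnerProductSpace 𝕜 E] [CompleteSpace E] {A : E →L[𝕜] E} (hA : IsSelfAdjoint A) (x : E)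
    (k : ℕ) : ‖(A ^ (k + 1)) x‖ ^ 2 ≤ ‖(A ^ k) x‖ * ‖(A ^ (k + 2)) x‖ := by
  have hsucc (m : ℕ) : (A ^ (m + 1)) x = A ((A ^ m) x) := by
    rw [pow_succ', mul_apply_eq_comp]
  have hsymm : inner 𝕜 ((A ^ (k + 1)) x) ((A ^ (k + 1)) x)
      = inner 𝕜 ((A ^ k) x) ((A ^ (k + 2)) x) := by
    rw [hsucc (k + 1)]
    nth_rewrite 1 [hsucc k]
    exact hA.isSymmetric _ _
  rw [← inner_self_eq_norm_sq (𝕜 := 𝕜), hsymm]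
  exact re_inner_le_norm _ _


/-- **Bernstein-type lemma.** If `A` is a bounded self-adjoint operator on a complex
Hilbert space, `σ > 0`, and `‖A^k f‖ ≤ C(f,σ) σ^k` for all `k ≥ 1`, then in fact
`‖A^k f‖ ≤ σ^k ‖f‖` for all `k ≥ 1`; in particular `sup_{k ≥ 1} σ^{-k} ‖A^k f‖ ≤ ‖f‖`. -/
theorem bernstein_lemma {H : Type*} [NormedAddCommGroup H] [InnerProductSpace ℂ H]
    [CompleteSpace H] (A : H →L[ℂ] H) (hA : IsSelfAdjoint A)
    (f : H) (σ : ℝ) (hσ : 0 < σ)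
    (C : ℝ) (hC : ∀ k : ℕ, 1 ≤ k → ‖(A ^ k) f‖ ≤ C * σ ^ k) :
    (∀ k : ℕ, 1 ≤ k → ‖(A ^ k) f‖ ≤ σ ^ k * ‖f‖) ∧
      sSup {x : ℝ | ∃ k : ℕ, 1 ≤ k ∧ x = σ⁻¹ ^ k * ‖(A ^ k) f‖} ≤ ‖f‖ := by
  have step := le_mul_of_logConvex_of_le_geometric (u := fun k => ‖(A ^ k) f‖)
    (fun _ => norm_nonneg _) (hA.norm_pow_apply_sq_le f) hσ hC
  have bound (k : ℕ) : ‖(A ^ k) f‖ ≤ σ ^ k * ‖f‖ := by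
    induction k with
    | zero => simp
    | succ k ih =>
      calc ‖(A ^ (k + 1)) f‖ ≤ σ * ‖(A ^ k) f‖ := step k
        _ ≤ σ * (σ ^ k * ‖f‖) := by gcongr
        _ = σ ^ (k + 1) * ‖f‖ := by ring
  refine ⟨fun k _ => bound k, csSup_le ⟨_, 1, le_rfl, rfl⟩ ?_⟩
  rintro _ ⟨k, -, rfl⟩
  rw [inv_pow, inv_mul_le_iff₀ (pow_pos hσ k)]
  exact bound k
end

section
/- (Kolmogorov–Stein-type inequality for operators.) Let H be a complex Hilbert space and let A : H → H be a bounded self-adjoint linear operator. Then for every f ∈ H and all natural numbers m, k with 0 ≤ m ≤ k and k ≥ 1: ‖A^m f‖ ≤ π · ‖A^k f‖^{m/k} · ‖f‖^{1 − m/k}. -/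
/-- A nonnegative log-convex sequence satisfies `a n ^ (n + 1) ≤ a (n + 1) ^ n * a 0`. -/
theorem pow_succ_le_of_logConvex {a : ℕ → ℝ} (h0 : ∀ n, 0 ≤ a n)
    (h : ∀ n, a (n + 1) ^ 2 ≤ a n * a (n + 2)) (n : ℕ) :
    a n ^ (n + 1) ≤ a (n + 1) ^ n * a 0 := by
  induction n with
  | zero => simp
  | succ n ih =>
    rcases (h0 (n + 1)).eq_or_lt with hz | hpos
    · rw [← hz, zero_pow (by lia)]
      exact mul_nonneg (pow_nonneg (h0 _) _) (h0 0)
    · refine le_of_mul_le_mul_left ?_ (pow_pos hpos n)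
      calc a (n + 1) ^ n * a (n + 1) ^ (n + 1 + 1) = (a (n + 1) ^ 2) ^ (n + 1) := by ring
        _ ≤ (a n * a (n + 2)) ^ (n + 1) := pow_le_pow_left₀ (sq_nonneg _) (h n) _
        _ = a n ^ (n + 1) * a (n + 2) ^ (n + 1) := mul_pow _ _ _
        _ ≤ a (n + 1) ^ n * a 0 * a (n + 2) ^ (n + 1) :=
          mul_le_mul_of_nonneg_right ih (pow_nonneg (h0 _) _)
        _ = a (n + 1) ^ n * (a (n + 1 + 1) ^ (n + 1) * a 0) := by ring

/-- Interpolation between the terms `0` and `m + d` of a nonnegative log-convex sequence. -/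
theorem pow_add_le_of_logConvex {a : ℕ → ℝ} (h0 : ∀ n, 0 ≤ a n)
    (h : ∀ n, a (n + 1) ^ 2 ≤ a n * a (n + 2)) (m d : ℕ) :
    a m ^ (m + d) ≤ a (m + d) ^ m * a 0 ^ d := by
  induction d with
  | zero => simp
  | succ d ih =>
    rcases Nat.eq_zero_or_pos (m + d) with hz | hpos
    · obtain ⟨rfl, rfl⟩ : m = 0 ∧ d = 0 := by lia
      simp
    · have hR : 0 ≤ a (m + d + 1) ^ m * a 0 ^ (d + 1) :=
        mul_nonneg (pow_nonneg (h0 _) _) (pow_nonneg (h0 _) _)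
      refine le_of_pow_le_pow_left₀ hpos.ne' hR ?_
      calc (a m ^ (m + (d + 1))) ^ (m + d) = (a m ^ (m + d)) ^ (m + d + 1) := by ring
        _ ≤ (a (m + d) ^ m * a 0 ^ d) ^ (m + d + 1) :=
          pow_le_pow_left₀ (pow_nonneg (h0 _) _) ih _
        _ = (a (m + d) ^ (m + d + 1)) ^ m * a 0 ^ (d * (m + d + 1)) := by
          rw [mul_pow, ← pow_mul, ← pow_mul, ← pow_mul, mul_comm m]
        _ ≤ (a (m + d + 1) ^ (m + d) * a 0) ^ m * a 0 ^ (d * (m + d + 1)) :=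
          mul_le_mul_of_nonneg_right
            (pow_le_pow_left₀ (pow_nonneg (h0 _) _) (pow_succ_le_of_logConvex h0 h _) _)
            (pow_nonneg (h0 _) _)
        _ = (a (m + d + 1) ^ m * a 0 ^ (d + 1)) ^ (m + d) := by ring

/-- The norms of the iterates of a self-adjoint operator on a vector are log-convex. -/
theorem IsSelfAdjoint.norm_pow_apply_logConvex {H : Type*} [NormedAddCommGroup H]
    [InnerProductSpace ℂ H] [CompleteSpace H] {A : H →L[ℂ] H} (hA : IsSelfAdjoint A) (f : H)
    (n : ℕ) :
    ‖(A ^ (n + 1)) f‖ ^ 2 ≤ ‖(A ^ n) f‖ * ‖(A ^ (n + 2)) f‖ := by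
  have hs (j : ℕ) : (A ^ (j + 1)) f = A ((A ^ j) f) := by
    rw [pow_succ', mul_apply_eq_comp]
  have key : inner ℂ ((A ^ (n + 1)) f) ((A ^ (n + 1)) f)
      = inner ℂ ((A ^ n) f) ((A ^ (n + 2)) f) := by
    rw [hs (n + 1), hs n]
    exact hA.isSymmetric _ _
  calc ‖(A ^ (n + 1)) f‖ ^ 2 = ‖inner ℂ ((A ^ (n + 1)) f) ((A ^ (n + 1)) f)‖ := by
        rw [inner_self_eq_norm_sq_to_K]; simp
    _ ≤ ‖(A ^ n) f‖ * ‖(A ^ (n + 2)) f‖ := key ▸ norm_inner_le_norm _ _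

/-- **Kolmogorov–Stein-type inequality for operators.** For a bounded self-adjoint
operator `A` on a complex Hilbert space, `‖A^m f‖ ≤ π ‖A^k f‖^{m/k} ‖f‖^{1-m/k}`
whenever `0 ≤ m ≤ k`, `k ≥ 1`. -/
theorem kolmogorov_stein {H : Type*} [NormedAddCommGroup H] [InnerProductSpace ℂ H]
    [CompleteSpace H] (A : H →L[ℂ] H) (hA : IsSelfAdjoint A) (f : H)
    (m k : ℕ) (hmk : m ≤ k) (hk : 1 ≤ k) :
    ‖(A ^ m) f‖ ≤
      Real.pi * ‖(A ^ k) f‖ ^ ((m : ℝ) / k) * ‖f‖ ^ (1 - (m : ℝ) / k) := by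
  have hk0 : (k : ℝ) ≠ 0 := by positivity
  have hX : 0 ≤ ‖(A ^ k) f‖ ^ ((m : ℝ) / k) * ‖f‖ ^ (1 - (m : ℝ) / k) := by positivity
  have hmain : ‖(A ^ m) f‖ ≤ ‖(A ^ k) f‖ ^ ((m : ℝ) / k) * ‖f‖ ^ (1 - (m : ℝ) / k) := by
    obtain ⟨d, rfl⟩ := Nat.exists_eq_add_of_le hmk
    refine le_of_pow_le_pow_left₀ (n := m + d) (by lia) hX ?_
    have hd : (1 - (m : ℝ) / (m + d : ℕ)) * (m + d : ℕ) = d := by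
      rw [sub_mul, div_mul_cancel₀ _ hk0]
      push_cast
      ring
    rw [mul_pow, ← Real.rpow_mul_natCast (norm_nonneg _), ← Real.rpow_mul_natCast (norm_nonneg _),
      div_mul_cancel₀ _ hk0, hd, Real.rpow_natCast, Real.rpow_natCast]
    simpa using pow_add_le_of_logConvex (a := fun n => ‖(A ^ n) f‖) (fun _ => norm_nonneg _)
      (hA.norm_pow_apply_logConvex f) m d
  rw [mul_assoc]
  exact hmain.trans (le_mul_of_one_le_left hX (by linarith [Real.pi_gt_three]))
end

section
/- Let H be a complex Hilbert space, let A : H → H be a bounded self-adjoint linear operator, and let f ∈ H. Then the sequence k ↦ ‖A^k f‖^{1/k} converges as k → ∞; moreover, if f ≠ 0, its limit equals the infimum of the set {σ > 0 : ‖A^k f‖ ≤ σ^k ‖f‖ for all k ∈ ℕ, k ≥ 1}. -/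
/-- If `c` is nonnegative and log-convex with `c 0 = 1`, then `c k ^ (1 / k)` is increasing;
this is the form of that fact without roots. -/
theorem pow_succ_le_pow_of_sq_le_mul {c : ℕ → ℝ} (hc : ∀ k, 0 ≤ c k) (h0 : c 0 = 1)
    (hlog : ∀ k, c (k + 1) ^ 2 ≤ c k * c (k + 2)) (k : ℕ) :
    c k ^ (k + 1) ≤ c (k + 1) ^ k := by
  induction k with
  | zero => simp [h0]
  | succ k ih =>
    rcases (hc (k + 1)).eq_or_lt with h | h
    · rw [← h, zero_pow (by omega)]
      exact pow_nonneg (hc _) _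
    · refine le_of_mul_le_mul_left ?_ (pow_pos h k)
      calc c (k + 1) ^ k * c (k + 1) ^ (k + 1 + 1) = (c (k + 1) ^ 2) ^ (k + 1) := by ring
        _ ≤ (c k * c (k + 2)) ^ (k + 1) := by gcongr; exact hlog k
        _ = c k ^ (k + 1) * c (k + 2) ^ (k + 1) := mul_pow _ _ _
        _ ≤ c (k + 1) ^ k * c (k + 1 + 1) ^ (k + 1) :=
          mul_le_mul_of_nonneg_right ih (pow_nonneg (hc _) _)

/-- A nonnegative log-convex sequence with `c 0 = 1` and at most geometric growth has a root limit,
which is the infimum of its geometric growth bounds. -/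
theorem tendsto_rpow_inv_sInf_of_sq_le_mul {c : ℕ → ℝ} (hc : ∀ k, 0 ≤ c k) (h0 : c 0 = 1)
    (hlog : ∀ k, c (k + 1) ^ 2 ≤ c k * c (k + 2)) {M : ℝ} (hM : 0 ≤ M)
    (hcM : ∀ k, c k ≤ M ^ k) :
    Filter.Tendsto (fun k : ℕ => c k ^ ((k : ℝ)⁻¹)) Filter.atTop
      (nhds (sInf {σ : ℝ | 0 < σ ∧ ∀ k : ℕ, 1 ≤ k → c k ≤ σ ^ k})) := by
  set b : ℕ → ℝ := fun n => c (n + 1) ^ (((n + 1 : ℕ) : ℝ)⁻¹) with hb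
  have hb0 : ∀ n, 0 ≤ b n := fun n => Real.rpow_nonneg (hc _) _
  have hbpow : ∀ n, b n ^ (n + 1) = c (n + 1) := fun n =>
    Real.rpow_inv_natCast_pow (hc _) n.succ_ne_zero
  have hble : ∀ n σ, 0 ≤ σ → (b n ≤ σ ↔ c (n + 1) ≤ σ ^ (n + 1)) := fun n σ hσ => by
    rw [← hbpow, pow_le_pow_iff_left₀ (hb0 n) hσ n.succ_ne_zero]
  have hmono : Monotone b := by
    refine monotone_nat_of_le_succ fun n => ?_
    have h := pow_succ_le_pow_of_sq_le_mul hc h0 hlog (n + 1)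
    rw [← hbpow, ← hbpow (n + 1), ← pow_mul, ← pow_mul, mul_comm (n + 1 + 1) (n + 1)] at h
    exact (pow_le_pow_iff_left₀ (hb0 _) (hb0 _) (by positivity)).1 h
  have hbdd : BddAbove (Set.range b) :=
    ⟨M, Set.forall_mem_range.2 fun n => (hble n M hM).2 (hcM _)⟩
  have hL0 : 0 ≤ ⨆ n, b n := Real.iSup_nonneg hb0
  have hmem : ∀ σ, (⨆ n, b n) < σ → 0 < σ ∧ ∀ k : ℕ, 1 ≤ k → c k ≤ σ ^ k := by
    refine fun σ hσ => ⟨hL0.trans_lt hσ, fun k hk => ?_⟩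
    obtain ⟨n, rfl⟩ := Nat.exists_eq_add_of_le' hk
    exact (hble n σ (hL0.trans hσ.le)).1 ((le_ciSup hbdd n).trans hσ.le)
  have hinf : sInf {σ : ℝ | 0 < σ ∧ ∀ k : ℕ, 1 ≤ k → c k ≤ σ ^ k} = ⨆ n, b n := by
    refine csInf_eq_of_forall_ge_of_forall_gt_exists_lt ⟨_, hmem _ (lt_add_one _)⟩ ?_ ?_
    · rintro σ ⟨hσ, h⟩
      exact ciSup_le fun n => (hble n σ hσ.le).2 (h _ n.succ_pos)
    · intro w hw
      obtain ⟨σ, hσ, hσw⟩ := exists_between hw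
      exact ⟨σ, hmem σ hσ, hσw⟩
  rw [hinf]
  exact (Filter.tendsto_add_atTop_iff_nat 1).1 (tendsto_atTop_ciSup hmono hbdd)

theorem IsSelfAdjoint.norm_apply_sq_le {H : Type*} [NormedAddCommGroup H]
    [InnerProductSpace ℂ H] [CompleteSpace H] {A : H →L[ℂ] H} (hA : IsSelfAdjoint A) (x : H) :
    ‖A x‖ ^ 2 ≤ ‖x‖ * ‖A (A x)‖ := by
  rw [← inner_self_eq_norm_sq (𝕜 := ℂ), hA.isSymmetric.apply_clm x (A x)]
  exact (RCLike.re_le_norm _).trans (norm_inner_le_norm _ _)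

/-- For a bounded self-adjoint operator `A` on a complex Hilbert space and `f ∈ H`,
the sequence `k ↦ ‖A^k f‖^{1/k}` converges; if `f ≠ 0` its limit is the infimum of
the set of all `σ > 0` for which the Bernstein inequality `‖A^k f‖ ≤ σ^k ‖f‖`
holds for all `k ≥ 1`. -/
theorem norm_pow_root_tendsto {H : Type*} [NormedAddCommGroup H]
    [InnerProductSpace ℂ H] [CompleteSpace H]
    (A : H →L[ℂ] H) (hA : IsSelfAdjoint A) (f : H) :
    ∃ L : ℝ,
      Filter.Tendsto (fun k : ℕ => ‖(A ^ k) f‖ ^ ((k : ℝ)⁻¹)) Filter.atTop (nhds L) ∧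
      (f ≠ 0 →
        L = sInf {σ : ℝ | 0 < σ ∧ ∀ k : ℕ, 1 ≤ k → ‖(A ^ k) f‖ ≤ σ ^ k * ‖f‖}) := by
  rcases eq_or_ne f 0 with rfl | hf
  · refine ⟨0, tendsto_const_nhds.congr' ?_, fun h => absurd rfl h⟩
    filter_upwards [Filter.eventually_ge_atTop 1] with k hk
    rw [map_zero, norm_zero, Real.zero_rpow (by positivity)]
  have hf0 : 0 < ‖f‖ := norm_pos_iff.2 hf
  refine ⟨_, ?_, fun _ => rfl⟩
  have hlog (k : ℕ) : (‖(A ^ (k + 1)) f‖ / ‖f‖) ^ 2 ≤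
      ‖(A ^ k) f‖ / ‖f‖ * (‖(A ^ (k + 2)) f‖ / ‖f‖) := by
    have h := hA.norm_apply_sq_le ((A ^ k) f)
    rw [div_pow, div_mul_div_comm, ← sq, pow_succ' A (k + 1), pow_succ' A k]
    exact div_le_div_of_nonneg_right h (by positivity)
  have hgrowth (k : ℕ) : ‖(A ^ k) f‖ / ‖f‖ ≤ ‖A‖ ^ k := by
    rw [div_le_iff₀ hf0]
    induction k with
    | zero => simp
    | succ k ih =>
      rw [pow_succ' A k, pow_succ', mul_assoc]
      exact (A.le_opNorm _).trans (mul_le_mul_of_nonneg_left ih (norm_nonneg A))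
  have hlim := tendsto_rpow_inv_sInf_of_sq_le_mul (c := fun k => ‖(A ^ k) f‖ / ‖f‖)
    (fun k => by positivity) (by simp [hf]) hlog (norm_nonneg A) hgrowth
  have hroot : Filter.Tendsto (fun k : ℕ => ‖f‖ ^ ((k : ℝ)⁻¹)) Filter.atTop (nhds 1) := by
    simpa [Function.comp_def] using (Real.continuous_const_rpow hf0.ne').continuousAt.tendsto.comp
      (tendsto_inv_atTop_nhds_zero_nat (𝕜 := ℝ))
  have hprod := hlim.mul hroot
  simp only [div_le_iff₀ hf0, mul_one] at hprod
  refine hprod.congr fun k => ?_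
  rw [← Real.mul_rpow (by positivity) hf0.le, div_mul_cancel₀ _ hf0.ne']
end
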